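/- Single-trial probabilistic guarantee underlying Theorem 5.1 (multilinear form optimization over roots of unity, with the final bilinear subproblem solved exactly): For every δ ∈ (0, 1/16) there exists a constant c > 0, depending only on δ, with the following property. Let m ≥ 3 be an integer, let d ≥ 2, let n₁, …, n_d ≥ 2, and let F : ℂ^{n₁} × ⋯ × ℂ^{n_d} → ℂ be a ℂ-multilinear form. Let ξ^1, …, ξ^{d−2} be independent random vectors, where all entries of all ξ^k are i.i.d. uniform on Ω_m (so ξ^k is uniform on Ω_m^{n_k}). Set v_max = max{ Re F(x^1, …, x^d) : x^k ∈ Ω_m^{n_k} for k = 1, …, d }. Then with probability at least (c / c₂(m))^{d−2} · ∏_{k=1}^{d−2} n_k^{−5δ}, one has max{ Re F(ξ^1, …, ξ^{d−2}, x^{d−1}, x^d) : x^{d−1} ∈ Ω_m^{n_{d−1}}, x^d ∈ Ω_m^{n_d} } ≥ δ^{(d−2)/2} · ( ∏_{k=1}^{d−2} ln(n_k)/n_k )^{1/2} · v_max. -/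

import Mathlib

open scoped BigOperators

/-- `omegaRoot m k = e^{2πik/m}`; for `k ∈ Fin m` these enumerate the `m`-th roots of
unity `Ω_m`, so a uniform random variable on `Fin m` composed with `omegaRoot m` is
uniform on `Ω_m`. -/
noncomputable def omegaRoot (m k : ℕ) : ℂ :=
  Complex.exp (2 * Real.pi * Complex.I * k / m)

section RootTail

lemma omegaRoot_eq_pow (m k : ℕ) :
    omegaRoot m k = Complex.exp (2 * Real.pi * Complex.I / m) ^ k := by
  rw [omegaRoot, ← Complex.exp_nat_mul]
  congr 1
  ring

lemma norm_omegaRoot (m k : ℕ) : ‖omegaRoot m k‖ = 1 := by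
  rw [omegaRoot, Complex.norm_exp]
  have h : (2 * Real.pi * Complex.I * k / m : ℂ) = ((2 * Real.pi * k / m : ℝ) : ℂ) * Complex.I := by
    push_cast
    ring
  rw [h]
  simp

lemma sum_omegaRoot_pow {m r : ℕ} (hr : 0 < r) (hrm : r < m) :
    ∑ j : Fin m, omegaRoot m j ^ r = 0 := by
  have hp := Complex.isPrimitiveRoot_exp m (by omega)
  have h1 : Complex.exp (2 * Real.pi * Complex.I / m) ^ r ≠ 1 :=
    hp.pow_ne_one_of_pos_of_lt hr.ne' hrm
  have h2 : (Complex.exp (2 * Real.pi * Complex.I / m) ^ r) ^ m = 1 := by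
    rw [pow_right_comm, hp.pow_eq_one, one_pow]
  simp_rw [omegaRoot_eq_pow, ← pow_mul, mul_comm _ r, pow_mul]
  rw [Fin.sum_univ_eq_sum_range
    (fun j => (Complex.exp (2 * Real.pi * Complex.I / m) ^ r) ^ j) m, geom_sum_eq h1, h2]
  simp

lemma sum_re_mul_omegaRoot {m : ℕ} (hm : 3 ≤ m) (a : ℂ) :
    ∑ j : Fin m, (a * omegaRoot m j).re = 0 := by
  have h := sum_omegaRoot_pow (m := m) one_pos (by omega)
  simp only [pow_one] at h
  rw [← Complex.re_sum, ← Finset.mul_sum, h]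
  simp

lemma sum_re_mul_omegaRoot_sq {m : ℕ} (hm : 3 ≤ m) (a : ℂ) :
    ∑ j : Fin m, (a * omegaRoot m j).re ^ 2 = m * ‖a‖ ^ 2 / 2 := by
  have h := sum_omegaRoot_pow (m := m) two_pos (by omega)
  have key : ∀ z : ℂ, z.re ^ 2 = ‖z‖ ^ 2 / 2 + (z ^ 2).re / 2 := fun z => by
    rw [Complex.sq_norm, Complex.normSq_apply, pow_two z, Complex.mul_re]
    ring
  simp_rw [key, norm_mul, norm_omegaRoot, mul_pow]
  rw [Finset.sum_add_distrib, ← Finset.sum_div, ← Finset.sum_div, ← Complex.re_sum,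
    ← Finset.mul_sum _ _ (a ^ 2), h]
  simp

lemma abs_re_mul_omegaRoot_le (m j : ℕ) (a : ℂ) : |(a * omegaRoot m j).re| ≤ ‖a‖ := by
  refine (Complex.abs_re_le_norm _).trans ?_
  rw [norm_mul, norm_omegaRoot, mul_one]

lemma abs_exp_sub_quadratic_le {x : ℝ} (hx : |x| ≤ 1 / 100) :
    |Real.exp x - (1 + x + x ^ 2 / 2)| ≤ x ^ 2 / 400 := by
  have h := Real.exp_bound (x := x) (by linarith) (n := 3) (by norm_num)
  simp only [Finset.sum_range_succ, Finset.sum_range_zero] at h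
  norm_num [Nat.factorial] at h
  refine h.trans ?_
  rw [pow_succ, sq_abs]
  nlinarith [sq_nonneg x, abs_nonneg x]

lemma sum_exp_re_mul_omegaRoot_le {m : ℕ} (hm : 3 ≤ m) (a : ℂ) {l : ℝ} (hl : 0 ≤ l)
    (h : l * ‖a‖ ≤ 1 / 100) :
    ∑ j : Fin m, Real.exp (l * (a * omegaRoot m j).re) ≤
      m * Real.exp (101 / 400 * l ^ 2 * ‖a‖ ^ 2) := by
  calc ∑ j : Fin m, Real.exp (l * (a * omegaRoot m j).re)
      ≤ ∑ j : Fin m, (1 + l * (a * omegaRoot m j).re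
          + 101 / 200 * l ^ 2 * (a * omegaRoot m j).re ^ 2) := by
        refine Finset.sum_le_sum fun j _ => ?_
        have hx : |l * (a * omegaRoot m j).re| ≤ 1 / 100 := by
          rw [abs_mul, abs_of_nonneg hl]
          exact (mul_le_mul_of_nonneg_left (abs_re_mul_omegaRoot_le m j a) hl).trans h
        have := (abs_le.1 (abs_exp_sub_quadratic_le hx)).2
        nlinarith [sq_nonneg (l * (a * omegaRoot m j).re)]
    _ = m * (101 / 400 * l ^ 2 * ‖a‖ ^ 2 + 1) := by
        rw [Finset.sum_add_distrib, Finset.sum_add_distrib, ← Finset.mul_sum, ← Finset.mul_sum,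
          sum_re_mul_omegaRoot hm, sum_re_mul_omegaRoot_sq hm]
        simp
        ring
    _ ≤ _ := by
        gcongr
        exact Real.add_one_le_exp _

lemma le_sum_exp_re_mul_omegaRoot {m : ℕ} (hm : 3 ≤ m) (a : ℂ) {l : ℝ} (hl : 0 ≤ l)
    (h : l * ‖a‖ ≤ 1 / 100) :
    m * Real.exp (99 / 400 * l ^ 2 * ‖a‖ ^ 2) ≤
      ∑ j : Fin m, Real.exp (l * (a * omegaRoot m j).re) := by
  calc m * Real.exp (99 / 400 * l ^ 2 * ‖a‖ ^ 2)
      ≤ m * (199 / 800 * l ^ 2 * ‖a‖ ^ 2 + 1) := by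
        gcongr
        have h0 : 0 ≤ l * ‖a‖ := by positivity
        have h2 : l ^ 2 * ‖a‖ ^ 2 ≤ 1 / 10000 := by
          rw [← mul_pow]
          nlinarith
        have h3 : 0 ≤ l ^ 2 * ‖a‖ ^ 2 := by positivity
        set y := l ^ 2 * ‖a‖ ^ 2 with hy
        have := (abs_le.1 (Real.abs_exp_sub_one_sub_id_le (x := 99 / 400 * y)
          (by rw [abs_of_nonneg (by positivity)]; linarith))).2
        rw [mul_assoc, mul_assoc, ← hy]
        nlinarith
    _ = ∑ j : Fin m, (1 + l * (a * omegaRoot m j).re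
          + 199 / 400 * l ^ 2 * (a * omegaRoot m j).re ^ 2) := by
        rw [Finset.sum_add_distrib, Finset.sum_add_distrib, ← Finset.mul_sum, ← Finset.mul_sum,
          sum_re_mul_omegaRoot hm, sum_re_mul_omegaRoot_sq hm]
        simp
        ring
    _ ≤ _ := by
        refine Finset.sum_le_sum fun j _ => ?_
        have hx : |l * (a * omegaRoot m j).re| ≤ 1 / 100 := by
          rw [abs_mul, abs_of_nonneg hl]
          exact (mul_le_mul_of_nonneg_left (abs_re_mul_omegaRoot_le m j a) hl).trans h
        have := (abs_le.1 (abs_exp_sub_quadratic_le hx)).1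
        nlinarith [sq_nonneg (l * (a * omegaRoot m j).re)]

/-- The real part of `∑ i, a i ξ i`, where the phases `ξ i` are the roots of unity selected
by `K`. -/
noncomputable def phaseSum {ι : Type*} [Fintype ι] (m : ℕ) (a : ι → ℂ) (K : ι → Fin m) : ℝ :=
  ∑ i, (a i * omegaRoot m (K i)).re

/-- The number of choices of phases for which `phaseSum` is at least `T`. -/
noncomputable def tailCount {ι : Type*} [Fintype ι] [DecidableEq ι] (m : ℕ) (a : ι → ℂ)
    (T : ℝ) : ℕ :=
  (Finset.univ.filter fun K : ι → Fin m => T ≤ phaseSum m a K).card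

variable {ι : Type*} [Fintype ι] [DecidableEq ι]

lemma sum_exp_mul_phaseSum (m : ℕ) (a : ι → ℂ) (l : ℝ) :
    ∑ K : ι → Fin m, Real.exp (l * phaseSum m a K) =
      ∏ i, ∑ j : Fin m, Real.exp (l * (a i * omegaRoot m j).re) := by
  rw [Finset.prod_univ_sum, Fintype.piFinset_univ]
  refine Finset.sum_congr rfl fun K _ => ?_
  rw [phaseSum, Finset.mul_sum, Real.exp_sum]

lemma sum_exp_mul_phaseSum_le {m : ℕ} (hm : 3 ≤ m) (a : ι → ℂ) {l : ℝ} (hl : 0 ≤ l)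
    (h : ∀ i, l * ‖a i‖ ≤ 1 / 100) :
    ∑ K : ι → Fin m, Real.exp (l * phaseSum m a K) ≤
      (m : ℝ) ^ Fintype.card ι * Real.exp (101 / 400 * l ^ 2 * ∑ i, ‖a i‖ ^ 2) := by
  rw [sum_exp_mul_phaseSum, Finset.mul_sum, Real.exp_sum, ← Finset.card_univ, ← Finset.prod_const,
    ← Finset.prod_mul_distrib]
  exact Finset.prod_le_prod (fun _ _ => by positivity)
    fun i _ => sum_exp_re_mul_omegaRoot_le hm (a i) hl (h i)

lemma le_sum_exp_mul_phaseSum {m : ℕ} (hm : 3 ≤ m) (a : ι → ℂ) {l : ℝ} (hl : 0 ≤ l)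
    (h : ∀ i, l * ‖a i‖ ≤ 1 / 100) :
    (m : ℝ) ^ Fintype.card ι * Real.exp (99 / 400 * l ^ 2 * ∑ i, ‖a i‖ ^ 2) ≤
      ∑ K : ι → Fin m, Real.exp (l * phaseSum m a K) := by
  rw [sum_exp_mul_phaseSum, Finset.mul_sum, Real.exp_sum, ← Finset.card_univ, ← Finset.prod_const,
    ← Finset.prod_mul_distrib]
  exact Finset.prod_le_prod (fun _ _ => by positivity)
    fun i _ => le_sum_exp_re_mul_omegaRoot hm (a i) hl (h i)

/-- Gaussian-type lower tail bound obtained by exponential tilting. -/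
lemma le_tailCount_of_small {m : ℕ} (hm : 3 ≤ m) (a : ι → ℂ) {s t : ℝ} (hs : 0 < s) (ht : 0 < t)
    (hsa : ∑ i, ‖a i‖ ^ 2 = 2 * s ^ 2) (h : ∀ i, 800 / 3 * t * ‖a i‖ ≤ s) :
    (1 - Real.exp (-(t ^ 2 / 40))) ^ 2 * Real.exp (-(2 * t ^ 2)) * (m : ℝ) ^ Fintype.card ι ≤
      tailCount m a (t * s) := by
  set P : Finset (ι → Fin m) := Finset.univ.filter fun K => t * s ≤ phaseSum m a K with hP
  have hts : 0 < t / s := by positivity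
  have hb : ∀ r : ℝ, 0 ≤ r → r ≤ 8 / 3 → ∀ i, r * (t / s) * ‖a i‖ ≤ 1 / 100 := by
    intro r hr0 hr i
    have h1 := h i
    have h2 : t / s * ‖a i‖ ≤ 3 / 800 := by
      rw [div_mul_eq_mul_div, div_le_iff₀ hs]
      linarith
    have h3 : 0 ≤ t / s * ‖a i‖ := by positivity
    nlinarith
  have he : ∀ C r : ℝ, C * (r * (t / s)) ^ 2 * ∑ i, ‖a i‖ ^ 2 = 2 * C * r ^ 2 * t ^ 2 := by
    intro C r
    rw [hsa]
    field_simp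
  set N : ℝ := (m : ℝ) ^ Fintype.card ι with hN
  have hNpos : 0 < N := by
    have : 0 < m := by omega
    positivity
  have low := le_sum_exp_mul_phaseSum hm a (l := 4 / 3 * (t / s)) (by positivity)
    (hb _ (by norm_num) (by norm_num))
  have up1 := sum_exp_mul_phaseSum_le hm a (l := 1 * (t / s)) (by positivity)
    (hb _ (by norm_num) (by norm_num))
  have up2 := sum_exp_mul_phaseSum_le hm a (l := 8 / 3 * (t / s)) (by positivity)
    (hb _ (by norm_num) (by norm_num))
  rw [he, ← hN] at low up1 up2
  set E := Real.exp (22 / 25 * t ^ 2) with hE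
  set q := Real.exp (-(t ^ 2 / 40)) with hq
  have hq1 : q < 1 := by
    rw [hq, Real.exp_lt_one_iff]
    have : 0 < t ^ 2 := by positivity
    linarith
  -- the part of the exponential moment outside the event
  have hout : ∑ K ∈ Pᶜ, Real.exp (4 / 3 * (t / s) * phaseSum m a K) ≤ N * E * q := by
    calc ∑ K ∈ Pᶜ, Real.exp (4 / 3 * (t / s) * phaseSum m a K)
        ≤ ∑ K ∈ Pᶜ, Real.exp (t ^ 2 / 3) * Real.exp (1 * (t / s) * phaseSum m a K) := by
          refine Finset.sum_le_sum fun K hK => ?_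
          rw [← Real.exp_add, Real.exp_le_exp]
          have hK' : phaseSum m a K < t * s := by simpa [hP] using hK
          have : t / s * phaseSum m a K ≤ t / s * (t * s) := by gcongr
          have h2 : t / s * (t * s) = t ^ 2 := by field_simp
          linarith
      _ ≤ ∑ K, Real.exp (t ^ 2 / 3) * Real.exp (1 * (t / s) * phaseSum m a K) :=
          Finset.sum_le_univ_sum_of_nonneg fun _ => by positivity
      _ ≤ Real.exp (t ^ 2 / 3) * (N * Real.exp (2 * (101 / 400) * 1 ^ 2 * t ^ 2)) := by
          rw [← Finset.mul_sum]
          gcongr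
      _ = N * Real.exp (t ^ 2 / 3 + 2 * (101 / 400) * 1 ^ 2 * t ^ 2) := by
          rw [Real.exp_add]
          ring
      _ ≤ N * Real.exp (22 / 25 * t ^ 2 + -(t ^ 2 / 40)) := by
          refine mul_le_mul_of_nonneg_left (Real.exp_le_exp.2 ?_) hNpos.le
          nlinarith [sq_nonneg t]
      _ = N * E * q := by
          rw [Real.exp_add]
          ring
  have hin : N * E * (1 - q) ≤ ∑ K ∈ P, Real.exp (4 / 3 * (t / s) * phaseSum m a K) := by
    rw [← Finset.sum_add_sum_compl P] at low
    have : Real.exp (2 * (99 / 400) * (4 / 3) ^ 2 * t ^ 2) = E := by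
      rw [hE]
      congr 1
      ring
    rw [this] at low
    linarith
  have hcs : (∑ K ∈ P, Real.exp (4 / 3 * (t / s) * phaseSum m a K)) ^ 2 ≤
      P.card * (N * Real.exp (19 / 5 * t ^ 2 - t ^ 2 / 25)) := by
    refine (sq_sum_le_card_mul_sum_sq).trans ?_
    gcongr
    calc ∑ K ∈ P, Real.exp (4 / 3 * (t / s) * phaseSum m a K) ^ 2
        = ∑ K ∈ P, Real.exp (8 / 3 * (t / s) * phaseSum m a K) := by
          refine Finset.sum_congr rfl fun K _ => ?_
          rw [← Real.exp_nat_mul]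
          congr 1
          push_cast
          ring
      _ ≤ ∑ K, Real.exp (8 / 3 * (t / s) * phaseSum m a K) :=
          Finset.sum_le_univ_sum_of_nonneg fun _ => by positivity
      _ ≤ _ := up2
      _ ≤ _ := by
          gcongr
          nlinarith [sq_nonneg t]
  have hEq : E ^ 2 = Real.exp (-(2 * t ^ 2)) * Real.exp (19 / 5 * t ^ 2 - t ^ 2 / 25) := by
    rw [hE, ← Real.exp_nat_mul, ← Real.exp_add]
    congr 1
    push_cast
    ring
  have h0 : 0 ≤ N * E * (1 - q) := by
    have : 0 ≤ 1 - q := by linarith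
    positivity
  have h1 := (pow_le_pow_left₀ h0 hin 2).trans hcs
  have h2 : (N * E * (1 - q)) ^ 2 = ((1 - q) ^ 2 * Real.exp (-(2 * t ^ 2)) * N) *
      (N * Real.exp (19 / 5 * t ^ 2 - t ^ 2 / 25)) := by
    rw [mul_pow, mul_pow, hEq]
    ring
  rw [h2] at h1
  exact le_of_mul_le_mul_right h1 (by positivity)

lemma tailCount_anti (m : ℕ) (a : ι → ℂ) {T T' : ℝ} (h : T ≤ T') :
    tailCount m a T' ≤ tailCount m a T :=
  Finset.card_le_card fun K hK => by
    simp only [Finset.mem_filter, Finset.mem_univ, true_and] at hK ⊢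
    exact h.trans hK

/-- A constant lower bound for the probability of exceeding a thousandth of the standard
deviation. -/
noncomputable def smallDeviationConst : ℝ :=
  (1 - Real.exp (-((1 / 1000 : ℝ) ^ 2 / 40))) ^ 2 * Real.exp (-(2 * (1 / 1000 : ℝ) ^ 2))

lemma smallDeviationConst_pos : 0 < smallDeviationConst := by
  have : Real.exp (-((1 / 1000 : ℝ) ^ 2 / 40)) < 1 := by
    rw [Real.exp_lt_one_iff]
    norm_num
  have h : 0 < 1 - Real.exp (-((1 / 1000 : ℝ) ^ 2 / 40)) := by linarith
  rw [smallDeviationConst]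
  positivity

lemma smallDeviationConst_le_one : smallDeviationConst ≤ 1 := by
  have h1 : Real.exp (-((1 / 1000 : ℝ) ^ 2 / 40)) ≤ 1 := by
    rw [Real.exp_le_one_iff]
    norm_num
  have h2 : Real.exp (-(2 * (1 / 1000 : ℝ) ^ 2)) ≤ 1 := by
    rw [Real.exp_le_one_iff]
    norm_num
  have h3 := Real.exp_pos (-((1 / 1000 : ℝ) ^ 2 / 40))
  rw [smallDeviationConst]
  refine mul_le_one₀ ?_ (Real.exp_pos _).le h2
  exact pow_le_one₀ (by linarith) (by linarith)

lemma smallDeviationConst_mul_le_tailCount {m : ℕ} (hm : 3 ≤ m) (a : ι → ℂ) {s : ℝ} (hs : 0 ≤ s)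
    (hsa : ∑ i, ‖a i‖ ^ 2 = 2 * s ^ 2) :
    smallDeviationConst * (m : ℝ) ^ Fintype.card ι ≤ tailCount m a (1 / 1000 * s) := by
  rcases hs.eq_or_lt with rfl | hs
  · have ha : ∀ i, a i = 0 := by
      intro i
      have := (Finset.sum_eq_zero_iff_of_nonneg (fun i _ => sq_nonneg ‖a i‖)).1
        (hsa.trans (by norm_num)) i (Finset.mem_univ _)
      simpa using this
    have : tailCount m a (1 / 1000 * 0) = m ^ Fintype.card ι := by
      simp [tailCount, phaseSum, ha]
    rw [this]
    push_cast
    exact mul_le_of_le_one_left (by positivity) smallDeviationConst_le_one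
  · refine le_tailCount_of_small hm a hs (by norm_num) hsa fun i => ?_
    have h1 : ‖a i‖ ^ 2 ≤ 2 * s ^ 2 := by
      rw [← hsa]
      exact Finset.single_le_sum (f := fun i => ‖a i‖ ^ 2) (fun _ _ => by positivity)
        (Finset.mem_univ i)
    refine abs_le_of_sq_le_sq' ?_ hs.le |>.2
    nlinarith [sq_nonneg s]

/-- Independence of the phases on complementary sets of indices. -/
lemma tailCount_mul_tailCount_le (m : ℕ) (a : ι → ℂ) (p : ι → Prop) [DecidablePred p]
    (T₁ T₂ : ℝ) :
    tailCount m (fun i : {i // p i} => a i) T₁ * tailCount m (fun i : {i // ¬ p i} => a i) T₂ ≤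
      tailCount m a (T₁ + T₂) := by
  rw [tailCount, tailCount, ← Finset.card_product]
  refine Finset.card_le_card_of_injOn
    (Equiv.piEquivPiSubtypeProd p fun _ : ι => Fin m).symm ?_ (Equiv.injective _).injOn
  rintro ⟨K₁, K₂⟩ hK
  simp only [Finset.coe_product, Set.mem_prod, Finset.mem_coe, Finset.mem_filter,
    Finset.mem_univ, true_and] at hK ⊢
  refine (add_le_add hK.1 hK.2).trans_eq ?_
  simp only [phaseSum]
  rw [← Fintype.sum_subtype_add_sum_subtype p]
  congr 1 <;> refine Finset.sum_congr rfl fun i _ => ?_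
  · simp [Equiv.piEquivPiSubtypeProd, i.2]
  · simp [Equiv.piEquivPiSubtypeProd, i.2]

lemma card_le_mul_card_third {m : ℕ} (hm : 3 ≤ m) (a : ℂ) :
    (m : ℝ) / 8 ≤ (Finset.univ.filter fun j : Fin m => ‖a‖ / 3 ≤ (a * omegaRoot m j).re).card := by
  rcases (norm_nonneg a).eq_or_lt with h0 | h0
  · have : a = 0 := by simpa using h0.symm
    subst this
    simp
    linarith [(Nat.cast_nonneg m : (0 : ℝ) ≤ m)]
  have h1 : ∑ j : Fin m, ((a * omegaRoot m j).re + ‖a‖) * ((a * omegaRoot m j).re - ‖a‖ / 3) =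
      m * ‖a‖ ^ 2 / 6 := by
    have : ∀ j : Fin m, ((a * omegaRoot m j).re + ‖a‖) * ((a * omegaRoot m j).re - ‖a‖ / 3) =
        (a * omegaRoot m j).re ^ 2 + 2 / 3 * ‖a‖ * (a * omegaRoot m j).re - ‖a‖ ^ 2 / 3 :=
      fun j => by ring
    simp_rw [this]
    rw [Finset.sum_sub_distrib, Finset.sum_add_distrib, ← Finset.mul_sum,
      sum_re_mul_omegaRoot hm, sum_re_mul_omegaRoot_sq hm]
    simp
    ring
  have h2 : ∑ j : Fin m, ((a * omegaRoot m j).re + ‖a‖) * ((a * omegaRoot m j).re - ‖a‖ / 3) ≤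
      ∑ j : Fin m, if ‖a‖ / 3 ≤ (a * omegaRoot m j).re then 4 / 3 * ‖a‖ ^ 2 else 0 := by
    refine Finset.sum_le_sum fun j _ => ?_
    have h3 := abs_le.1 (abs_re_mul_omegaRoot_le m j a)
    split_ifs with hj
    · nlinarith
    · exact mul_nonpos_of_nonneg_of_nonpos (by linarith) (by linarith)
  rw [h1, ← Finset.sum_filter, Finset.sum_const, nsmul_eq_mul] at h2
  have h4 : 0 < ‖a‖ ^ 2 := by positivity
  have h5 : (m : ℝ) / 8 * (4 / 3 * ‖a‖ ^ 2) ≤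
      (Finset.univ.filter fun j : Fin m => ‖a‖ / 3 ≤ (a * omegaRoot m j).re).card *
        (4 / 3 * ‖a‖ ^ 2) := by
    linarith
  exact le_of_mul_le_mul_right h5 (by positivity)

lemma le_tailCount_third {m : ℕ} (hm : 3 ≤ m) (a : ι → ℂ) :
    (1 / 8 : ℝ) ^ Fintype.card ι * (m : ℝ) ^ Fintype.card ι ≤
      tailCount m a (1 / 3 * ∑ i, ‖a i‖) := by
  calc (1 / 8 : ℝ) ^ Fintype.card ι * (m : ℝ) ^ Fintype.card ι
      = ∏ _i : ι, (m : ℝ) / 8 := by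
        rw [Finset.prod_const, Finset.card_univ, ← mul_pow]
        congr 1
        ring
    _ ≤ ∏ i : ι, ((Finset.univ.filter fun j : Fin m =>
          ‖a i‖ / 3 ≤ (a i * omegaRoot m j).re).card : ℝ) :=
        Finset.prod_le_prod (fun _ _ => by positivity) fun i _ => card_le_mul_card_third hm (a i)
    _ = ((Fintype.piFinset fun i => Finset.univ.filter fun j : Fin m =>
          ‖a i‖ / 3 ≤ (a i * omegaRoot m j).re).card : ℝ) := by
        rw [Fintype.card_piFinset]
        push_cast
        rfl
    _ ≤ _ := by
        rw [tailCount]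
        gcongr
        intro K hK
        simp only [Fintype.mem_piFinset, Finset.mem_filter, Finset.mem_univ, true_and] at hK ⊢
        rw [phaseSum, Finset.mul_sum]
        exact Finset.sum_le_sum fun i _ => by linarith [hK i]


set_option maxHeartbeats 1000000 in
lemma le_tailCount_of_large {m n : ℕ} (hm : 3 ≤ m) (a : Fin n → ℂ) {δ L w : ℝ} (hδ : 0 < δ)
    (hδ' : δ < 1 / 16) (hw : 1 ≤ w) (hn : (n : ℝ) = w ^ 4) (hLw : L ≤ w / 10000000)
    (hL : 18 ≤ δ * L) :
    smallDeviationConst / 4 * Real.exp (-(5 * δ * L)) * (m : ℝ) ^ n ≤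
      tailCount m a (Real.sqrt (δ * (L / n)) * ∑ i, ‖a i‖) := by
  have hL0 : 0 < L := by
    by_contra h
    nlinarith
  have hw0 : 0 < w := by linarith
  have hn0 : (0 : ℝ) < n := by rw [hn]; positivity
  have hc := smallDeviationConst_pos
  set M : ℝ := (∑ i, ‖a i‖) / n with hM
  have hA : ∑ i, ‖a i‖ = M * w ^ 4 := by
    rw [hM, ← hn]
    field_simp
  have hM0 : 0 ≤ M := by positivity
  have hδL : δ * L ≤ w / 100000000 := by nlinarith
  have hT : ∀ r : ℝ, 0 ≤ r → δ * L * w ^ 4 * M ^ 2 ≤ r ^ 2 →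
      Real.sqrt (δ * (L / n)) * ∑ i, ‖a i‖ ≤ r := by
    intro r hr h
    refine abs_le_of_sq_le_sq' ?_ hr |>.2
    rw [mul_pow, Real.sq_sqrt (by positivity), hA, hn]
    refine le_trans (le_of_eq ?_) h
    field_simp
  let p : Fin n → Prop := fun i => ‖a i‖ ≤ M * w
  have hsplit : ∀ f : Fin n → ℝ, ∑ i : {i // p i}, f i + ∑ i : {i // ¬ p i}, f i = ∑ i, f i :=
    fun f => Fintype.sum_subtype_add_sum_subtype p f
  by_cases hbig : M * w ^ 4 / 10 ≤ ∑ i : {i // ¬ p i}, ‖a i‖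
  · -- the total variance is large
    have h2 : M ^ 2 * w ^ 5 / 10 ≤ ∑ i, ‖a i‖ ^ 2 := by
      calc M ^ 2 * w ^ 5 / 10 = M * w * (M * w ^ 4 / 10) := by ring
        _ ≤ M * w * ∑ i : {i // ¬ p i}, ‖a i‖ := by gcongr
        _ ≤ ∑ i : {i // ¬ p i}, ‖a i‖ ^ 2 := by
            rw [Finset.mul_sum]
            refine Finset.sum_le_sum fun i _ => ?_
            have : M * w < ‖a i‖ := not_le.1 i.2
            nlinarith [norm_nonneg (a i)]
        _ ≤ ∑ i, ‖a i‖ ^ 2 := by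
            rw [← hsplit fun i => ‖a i‖ ^ 2]
            exact le_add_of_nonneg_left (Finset.sum_nonneg fun _ _ => by positivity)
    set s : ℝ := Real.sqrt ((∑ i, ‖a i‖ ^ 2) / 2) with hs
    have hs2 : s ^ 2 = (∑ i, ‖a i‖ ^ 2) / 2 := Real.sq_sqrt (by positivity)
    have h3 := smallDeviationConst_mul_le_tailCount hm a (s := s) (Real.sqrt_nonneg _) (by linarith)
    rw [Fintype.card_fin] at h3
    have h4 : Real.sqrt (δ * (L / n)) * ∑ i, ‖a i‖ ≤ 1 / 1000 * s := by
      refine hT _ (by positivity) ?_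
      have : δ * L * (w ^ 4 * M ^ 2) ≤ w / 100000000 * (w ^ 4 * M ^ 2) := by gcongr
      nlinarith
    have h5 : (tailCount m a (1 / 1000 * s) : ℝ) ≤ _ := Nat.cast_le.2 (tailCount_anti m a h4)
    refine le_trans ?_ (h3.trans h5)
    gcongr
    have h6 : Real.exp (-(5 * δ * L)) ≤ 1 := by
      rw [Real.exp_le_one_iff]
      nlinarith
    nlinarith
  · push Not at hbig
    have hMpos : 0 < M := by
      have h0 : 0 ≤ ∑ i : {i // ¬ p i}, ‖a i‖ := by positivity
      have h1 : 0 < M * w ^ 4 := by linarith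
      exact pos_of_mul_pos_left h1 (by positivity)
    have h1 : 9 / 10 * (M * w ^ 4) ≤ ∑ i : {i // p i}, ‖a i‖ := by
      have := hsplit fun i => ‖a i‖
      linarith
    set s : ℝ := Real.sqrt ((∑ i : {i // p i}, ‖a i‖ ^ 2) / 2) with hs
    have hs2 : s ^ 2 = (∑ i : {i // p i}, ‖a i‖ ^ 2) / 2 := Real.sq_sqrt (by positivity)
    set s' : ℝ := Real.sqrt ((∑ i : {i // ¬ p i}, ‖a i‖ ^ 2) / 2) with hs'
    have hs2' : s' ^ 2 = (∑ i : {i // ¬ p i}, ‖a i‖ ^ 2) / 2 := Real.sq_sqrt (by positivity)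
    set t : ℝ := Real.sqrt (200 / 81 * (δ * L)) with ht
    have ht2 : t ^ 2 = 200 / 81 * (δ * L) := Real.sq_sqrt (by positivity)
    have ht0 : 0 < t := Real.sqrt_pos.2 (by positivity)
    have hvar : 81 / 200 * (M ^ 2 * w ^ 4) ≤ s ^ 2 := by
      have hcs := sq_sum_le_card_mul_sum_sq (s := (Finset.univ : Finset {i // p i}))
        (f := fun i => ‖a i‖)
      have hcard : ((Finset.univ : Finset {i // p i}).card : ℝ) ≤ w ^ 4 := by
        rw [← hn, Finset.card_univ]
        have := Fintype.card_subtype_le p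
        rw [Fintype.card_fin] at this
        exact_mod_cast this
      have h3 : (9 / 10 * (M * w ^ 4)) ^ 2 ≤ w ^ 4 * ∑ i : {i // p i}, ‖a i‖ ^ 2 :=
        (pow_le_pow_left₀ (by positivity) h1 2).trans (hcs.trans (by gcongr))
      have h4 : 81 / 100 * (M ^ 2 * w ^ 4) * w ^ 4 ≤ (∑ i : {i // p i}, ‖a i‖ ^ 2) * w ^ 4 := by
        linarith
      have h5 := le_of_mul_le_mul_right h4 (by positivity)
      linarith
    have hs0 : 0 < s := by
      refine lt_of_le_of_ne (Real.sqrt_nonneg _) fun h => ?_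
      rw [← h] at hvar
      have : 0 < M ^ 2 * w ^ 4 := by positivity
      linarith
    have htail := le_tailCount_of_small hm (fun i : {i // p i} => a i) hs0 ht0 (by linarith)
      fun i => by
        refine abs_le_of_sq_le_sq' ?_ hs0.le |>.2
        calc (800 / 3 * t * ‖a i‖) ^ 2 = 640000 / 9 * t ^ 2 * ‖a i‖ ^ 2 := by ring
          _ ≤ 640000 / 9 * (200 / 81 * (w / 100000000)) * (M * w) ^ 2 := by
            have : ‖a i‖ ≤ M * w := i.2
            rw [ht2]
            gcongr
          _ ≤ 81 / 200 * (M ^ 2 * w ^ 4) := by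
            have h3 : w ^ 3 ≤ w ^ 4 := pow_le_pow_right₀ hw (by norm_num)
            have h4 : M ^ 2 * w ^ 3 ≤ M ^ 2 * w ^ 4 := by gcongr
            have h5 : 0 ≤ M ^ 2 * w ^ 3 := by positivity
            nlinarith
          _ ≤ s ^ 2 := hvar
    have htail' := smallDeviationConst_mul_le_tailCount hm (fun i : {i // ¬ p i} => a i)
      (s := s') (Real.sqrt_nonneg _) (by linarith)
    have hTle : Real.sqrt (δ * (L / n)) * ∑ i, ‖a i‖ ≤ t * s + 1 / 1000 * s' := by
      have : Real.sqrt (δ * (L / n)) * ∑ i, ‖a i‖ ≤ t * s := by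
        refine hT _ (by positivity) ?_
        rw [mul_pow, ht2]
        have : δ * L * (81 / 200 * (M ^ 2 * w ^ 4)) ≤ δ * L * s ^ 2 := by gcongr
        linarith
      have h2 : 0 ≤ s' := Real.sqrt_nonneg _
      linarith
    have hcount := (tailCount_mul_tailCount_le m a p (t * s) (1 / 1000 * s')).trans
      (tailCount_anti m a hTle)
    have hcount' : (tailCount m (fun i : {i // p i} => a i) (t * s) : ℝ) *
        tailCount m (fun i : {i // ¬ p i} => a i) (1 / 1000 * s') ≤
          tailCount m a (Real.sqrt (δ * (L / n)) * ∑ i, ‖a i‖) := by exact_mod_cast hcount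
    refine le_trans ?_ ((mul_le_mul htail htail' (by positivity) (by positivity)).trans hcount')
    have hmn : (m : ℝ) ^ n =
        (m : ℝ) ^ Fintype.card {i // p i} * (m : ℝ) ^ Fintype.card {i // ¬ p i} := by
      rw [← pow_add]
      congr 1
      have h2 := Fintype.card_subtype_compl p
      have h3 := Fintype.card_subtype_le p
      rw [Fintype.card_fin] at h2 h3
      omega
    have hq : 1 / 4 ≤ (1 - Real.exp (-(t ^ 2 / 40))) ^ 2 := by
      have h2 : Real.exp (-(t ^ 2 / 40)) ≤ 1 / 2 := by
        calc Real.exp (-(t ^ 2 / 40)) ≤ Real.exp (-1) := by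
              rw [Real.exp_le_exp]
              linarith
          _ ≤ 1 / 2 := by
              rw [Real.exp_neg, ← one_div]
              exact one_div_le_one_div_of_le (by norm_num) (by linarith [Real.add_one_le_exp 1])
      nlinarith
    have hexp : Real.exp (-(5 * δ * L)) ≤ Real.exp (-(2 * t ^ 2)) := by
      rw [Real.exp_le_exp]
      linarith
    rw [hmn]
    calc _ = 1 / 4 * Real.exp (-(5 * δ * L)) * (m : ℝ) ^ Fintype.card {i // p i} *
          (smallDeviationConst * (m : ℝ) ^ Fintype.card {i // ¬ p i}) := by ring
      _ ≤ _ := by gcongr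

lemma exists_const_mul_le_tailCount {δ : ℝ} (hδ : 0 < δ) (hδ' : δ < 1 / 16) :
    ∃ c : ℝ, 0 < c ∧ ∀ m n : ℕ, 3 ≤ m → 2 ≤ n → ∀ a : Fin n → ℂ,
      c * ((n : ℝ) ^ (5 * δ))⁻¹ * (m : ℝ) ^ n ≤
        tailCount m a (Real.sqrt (δ * (Real.log n / n)) * ∑ i, ‖a i‖) := by
  have h1 : ∀ᶠ x : ℝ in Filter.atTop, Real.log x ≤ x ^ (1 / 4 : ℝ) / 10000000 := by
    have := (isLittleO_log_rpow_atTop (r := 1 / 4) (by norm_num)).bound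
      (c := 1 / 10000000) (by norm_num)
    filter_upwards [this, Filter.eventually_ge_atTop 1] with x hx hx1
    rw [Real.norm_of_nonneg (Real.log_nonneg hx1), Real.norm_of_nonneg (by positivity)] at hx
    linarith
  have h2 : ∀ᶠ x : ℝ in Filter.atTop, 18 / δ ≤ Real.log x :=
    Real.tendsto_log_atTop.eventually_ge_atTop _
  obtain ⟨n₀, hn₀⟩ := Filter.eventually_atTop.1
    (tendsto_natCast_atTop_atTop.eventually (h1.and h2))
  have hc := smallDeviationConst_pos
  refine ⟨min (smallDeviationConst / 4) ((1 / 8) ^ n₀), by positivity, fun m n hm hn a => ?_⟩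
  have hn1 : (1 : ℝ) ≤ n := by exact_mod_cast (by omega : 1 ≤ n)
  rcases le_total n₀ n with h | h
  · obtain ⟨h3, h4⟩ := hn₀ n h
    have h5 := le_tailCount_of_large hm a hδ hδ' (L := Real.log n) (w := (n : ℝ) ^ (1 / 4 : ℝ))
      (Real.one_le_rpow hn1 (by norm_num))
      (by rw [← Real.rpow_natCast, ← Real.rpow_mul (by positivity)]; norm_num) h3
      (by rw [div_le_iff₀ hδ] at h4; linarith)
    refine le_trans ?_ h5
    have h6 : ((n : ℝ) ^ (5 * δ))⁻¹ = Real.exp (-(5 * δ * Real.log n)) := by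
      rw [Real.exp_neg, Real.rpow_def_of_pos (by linarith), mul_comm]
    rw [h6]
    gcongr
    exact min_le_left _ _
  · have h3 := le_tailCount_third hm a
    rw [Fintype.card_fin] at h3
    have h4 : Real.sqrt (δ * (Real.log n / n)) * ∑ i, ‖a i‖ ≤ 1 / 3 * ∑ i, ‖a i‖ := by
      gcongr
      rw [Real.sqrt_le_left (by norm_num)]
      have h5 : Real.log n / n ≤ 1 := by
        rw [div_le_one (by linarith)]
        linarith [Real.log_le_sub_one_of_pos (x := n) (by linarith)]
      have h6 : 0 ≤ Real.log n / n := by positivity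
      nlinarith
    have h5 : (tailCount m a (1 / 3 * ∑ i, ‖a i‖) : ℝ) ≤ _ :=
      Nat.cast_le.2 (tailCount_anti m a h4)
    refine le_trans ?_ (h3.trans h5)
    gcongr
    have h6 : ((n : ℝ) ^ (5 * δ))⁻¹ ≤ 1 := inv_le_one_of_one_le₀ (Real.one_le_rpow hn1 (by positivity))
    calc min (smallDeviationConst / 4) ((1 / 8) ^ n₀) * ((n : ℝ) ^ (5 * δ))⁻¹
        ≤ (1 / 8) ^ n₀ * 1 := by
          gcongr
          exact min_le_right _ _
      _ ≤ (1 / 8) ^ n := by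
          rw [mul_one]
          exact pow_le_pow_of_le_one (by norm_num) (by norm_num) h

end RootTail

section Rounding

variable {d : ℕ} {n : Fin d → ℕ}

/-- The seeds `K` whose coordinates in `s` can be completed to a tuple of value at least `V`. -/
def roundingEvent (m : ℕ) (F : MultilinearMap ℂ (fun k : Fin d => (Fin (n k) → ℂ)) ℂ)
    (s : Finset (Fin d)) (V : ℝ) : Set ((k : Fin d) → (Fin (n k) → Fin m)) :=
  {K | ∃ x : (k : Fin d) → (Fin (n k) → Fin m), (∀ k ∈ s, x k = K k) ∧
    V ≤ (F (fun k i => omegaRoot m (x k i))).re}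

/-- Fixing one further coordinate at random. -/
lemma roundingEvent_insert {m : ℕ} (hm : 0 < m)
    (F : MultilinearMap ℂ (fun k : Fin d => (Fin (n k) → ℂ)) ℂ) (s : Finset (Fin d)) {k : Fin d}
    (hk : k ∉ s) {V τ q : ℝ} (hτ : 0 ≤ τ)
    (hq : ∀ a : Fin (n k) → ℂ, q * (m : ℝ) ^ n k ≤ tailCount m a (τ * ∑ i, ‖a i‖)) :
    q * (Nat.card (roundingEvent m F s V) : ℝ) ≤
      Nat.card (roundingEvent m F (insert k s) (τ * V)) := by
  classical
  simp only [Nat.card_eq_fintype_card, ← Set.toFinset_card]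
  set E := (roundingEvent m F s V).toFinset with hE
  set E' := (roundingEvent m F (insert k s) (τ * V)).toFinset with hE'
  have hfib : ∀ K ∈ E, q * (m : ℝ) ^ n k ≤
      ((Finset.univ.filter fun y : Fin (n k) → Fin m => Function.update K k y ∈ E').card : ℝ) := by
    intro K hK
    rw [hE, Set.mem_toFinset] at hK
    obtain ⟨x, hxs, hxV⟩ := hK
    set z : (k : Fin d) → (Fin (n k) → ℂ) := fun k i => omegaRoot m (x k i) with hz
    set a : Fin (n k) → ℂ := fun i => F (Function.update z k (Pi.single i 1)) with ha
    have hF : ∀ u : Fin (n k) → ℂ, F (Function.update z k u) = ∑ i, u i * a i := by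
      intro u
      have := LinearMap.pi_apply_eq_sum_univ (F.toLinearMap z k) u
      simp only [MultilinearMap.toLinearMap_apply, smul_eq_mul] at this
      rw [this]
      refine Finset.sum_congr rfl fun i _ => ?_
      rw [ha]
      congr 4
      ext j
      simp [Pi.single_apply, eq_comm]
    have hV : V ≤ ∑ i, ‖a i‖ := by
      refine hxV.trans ((Complex.re_le_norm _).trans ?_)
      rw [← Function.update_eq_self k z, hF]
      refine (norm_sum_le _ _).trans (Finset.sum_le_sum fun i _ => ?_)
      rw [norm_mul, hz, norm_omegaRoot, one_mul]
    refine (hq a).trans ?_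
    rw [tailCount]
    gcongr with y _
    intro hy
    rw [hE', Set.mem_toFinset]
    refine ⟨Function.update x k y, fun j hj => ?_, ?_⟩
    · rcases eq_or_ne j k with rfl | hjk
      · simp
      · rw [Function.update_of_ne hjk, Function.update_of_ne hjk]
        exact hxs j (Finset.mem_of_mem_insert_of_ne hj hjk)
    · have hupd : (fun j i => omegaRoot m (Function.update x k y j i)) =
          Function.update z k fun i => omegaRoot m (y i) := by
        ext j i
        rcases eq_or_ne j k with rfl | hjk
        · simp
        · simp [Function.update_of_ne hjk, hz]
      rw [hupd, hF, Complex.re_sum]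
      refine (mul_le_mul_of_nonneg_left hV hτ).trans (hy.trans_eq ?_)
      rw [phaseSum]
      simp_rw [mul_comm]
  have hinj : ∑ K ∈ E, (Finset.univ.filter fun y : Fin (n k) → Fin m =>
      Function.update K k y ∈ E').card ≤ m ^ n k * E'.card := by
    rw [← Finset.card_sigma]
    have : m ^ n k * E'.card = (E' ×ˢ (Finset.univ : Finset (Fin (n k) → Fin m))).card := by
      simp [mul_comm]
    rw [this]
    refine Finset.card_le_card_of_injOn (fun P => (Function.update P.1 k P.2, P.1 k)) ?_ ?_
    · rintro ⟨K, y⟩ hP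
      simpa using (Finset.mem_filter.1 (Finset.mem_sigma.1 hP).2).2
    · rintro ⟨K, y⟩ _ ⟨K', y'⟩ _ h
      simp only [Prod.mk.injEq] at h
      obtain ⟨h1, h2⟩ := h
      have hy : y = y' := by simpa using congrFun h1 k
      have hK : K = K' := by
        ext1 j
        rcases eq_or_ne j k with rfl | hjk
        · exact h2
        · simpa [Function.update_of_ne hjk] using congrFun h1 j
      rw [hy, hK]
  have h1 : (E.card : ℝ) * (q * (m : ℝ) ^ n k) ≤ (m : ℝ) ^ n k * E'.card := by
    calc (E.card : ℝ) * (q * (m : ℝ) ^ n k) = ∑ _K ∈ E, q * (m : ℝ) ^ n k := by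
          rw [Finset.sum_const, nsmul_eq_mul]
      _ ≤ ∑ K ∈ E, ((Finset.univ.filter fun y : Fin (n k) → Fin m =>
            Function.update K k y ∈ E').card : ℝ) := Finset.sum_le_sum hfib
      _ ≤ _ := by exact_mod_cast hinj
  have hpos : (0 : ℝ) < (m : ℝ) ^ n k := by positivity
  exact le_of_mul_le_mul_left (by linarith) hpos

lemma prod_mul_le_card_roundingEvent {m : ℕ} (hm : 0 < m)
    (F : MultilinearMap ℂ (fun k : Fin d => (Fin (n k) → ℂ)) ℂ) {V : ℝ}
    (hV : ∃ x : (k : Fin d) → (Fin (n k) → Fin m), V ≤ (F (fun k i => omegaRoot m (x k i))).re)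
    {τ q : Fin d → ℝ} (hτ : ∀ k, 0 ≤ τ k) (hq0 : ∀ k, 0 ≤ q k)
    (hq : ∀ k, ∀ a : Fin (n k) → ℂ, q k * (m : ℝ) ^ n k ≤ tailCount m a (τ k * ∑ i, ‖a i‖))
    (s : Finset (Fin d)) :
    (∏ k ∈ s, q k) * ∏ k, (m : ℝ) ^ n k ≤
      Nat.card (roundingEvent m F s ((∏ k ∈ s, τ k) * V)) := by
  classical
  induction s using Finset.induction_on with
  | empty =>
    obtain ⟨x, hx⟩ := hV
    have : roundingEvent m F ∅ ((∏ k ∈ ∅, τ k) * V) = Set.univ := by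
      ext K
      simp only [roundingEvent, Set.mem_ofPred_eq, Set.mem_univ, iff_true]
      exact ⟨x, by simp, by simpa using hx⟩
    rw [this]
    simp
  | insert k s hk ih =>
    rw [Finset.prod_insert hk, Finset.prod_insert hk, mul_assoc, mul_assoc]
    exact (mul_le_mul_of_nonneg_left ih (hq0 k)).trans
      (roundingEvent_insert hm F s hk (hτ k) (hq k))

end Rounding

/-- Single-trial probabilistic guarantee underlying Theorem 5.1.  The i.i.d. uniform
samples `ξ^1,…,ξ^{d−2}` on `Ω_m^{n_k}` are realized by sampling
`K : (k : Fin d) → Fin (n k) → Fin m` uniformly (entries `omegaRoot m ∘ K k`); the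
event only constrains the coordinates `k < d−2`.  `v_max` is the maximum of
`Re F` over all tuples with entries in `Ω_m`, written as an `sSup`; the assertion
"the bilinear maximum with `ξ^1,…,ξ^{d−2}` fixed is at least
`δ^{(d−2)/2}·(∏ ln n_k/n_k)^{1/2}·v_max`" is phrased as the existence of a feasible
tuple `x` agreeing with `K` on the first `d−2` coordinates achieving that value.
The probability is the counting measure divided by `∏_k m^{n_k}`, and
`c₂(m) = m.minFac`. -/
theorem single_trial_guarantee_multilinear_roots_of_unity :
    ∀ δ : ℝ, 0 < δ → δ < 1 / 16 → ∃ c : ℝ, 0 < c ∧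
      ∀ m d : ℕ, 3 ≤ m → 2 ≤ d → ∀ n : Fin d → ℕ, (∀ k, 2 ≤ n k) →
        ∀ F : MultilinearMap ℂ (fun k : Fin d => (Fin (n k) → ℂ)) ℂ,
          (c / (m.minFac : ℝ)) ^ (d - 2) *
              (∏ k ∈ Finset.univ.filter (fun k : Fin d => (k : ℕ) < d - 2),
                ((n k : ℝ)) ^ ((5 : ℝ) * δ))⁻¹
            ≤ (Nat.card {K : (k : Fin d) → (Fin (n k) → Fin m) //
                ∃ x : (k : Fin d) → (Fin (n k) → Fin m),
                  (∀ k : Fin d, (k : ℕ) < d - 2 → x k = K k) ∧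
                  Real.sqrt (δ ^ (d - 2) *
                      ∏ k ∈ Finset.univ.filter (fun k : Fin d => (k : ℕ) < d - 2),
                        Real.log (n k) / (n k)) *
                    sSup {r : ℝ | ∃ z : (k : Fin d) → (Fin (n k) → Fin m),
                        r = (F (fun k i => omegaRoot m (z k i))).re}
                    ≤ (F (fun k i => omegaRoot m (x k i))).re} : ℝ)
              / ∏ k, (m : ℝ) ^ (n k) := by
  intro δ hδ hδ'
  obtain ⟨c, hc, hcount⟩ := exists_const_mul_le_tailCount hδ hδ'
  refine ⟨c, hc, fun m d hm hd n hn F => ?_⟩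
  set S := Finset.univ.filter fun k : Fin d => (k : ℕ) < d - 2 with hS
  set R := {r : ℝ | ∃ z : (k : Fin d) → (Fin (n k) → Fin m),
    r = (F (fun k i => omegaRoot m (z k i))).re} with hR
  have hm0 : 0 < m := by omega
  have : Nonempty (Fin m) := ⟨⟨0, hm0⟩⟩
  have hRfin : R.Finite := by
    refine (Set.finite_range fun z : (k : Fin d) → (Fin (n k) → Fin m) =>
      (F (fun k i => omegaRoot m (z k i))).re).subset ?_
    rintro r ⟨z, rfl⟩
    exact ⟨z, rfl⟩
  have hRne : R.Nonempty :=
    ⟨_, fun _ _ => Classical.arbitrary (Fin m), rfl⟩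
  obtain ⟨x, hx⟩ := hRne.csSup_mem hRfin
  have hScard : S.card = d - 2 := by
    rw [hS, Fin.card_filter_val_lt]
    omega
  have hlog : ∀ k, 0 ≤ Real.log (n k) / (n k) := fun k => by positivity
  have key := prod_mul_le_card_roundingEvent hm0 F ⟨x, hx.le⟩
    (τ := fun k => Real.sqrt (δ * (Real.log (n k) / (n k))))
    (q := fun k => c * ((n k : ℝ) ^ (5 * δ))⁻¹) (fun _ => Real.sqrt_nonneg _)
    (fun _ => by positivity) (fun k a => hcount m (n k) hm (hn k) a) S
  have hsqrt : ∏ k ∈ S, Real.sqrt (δ * (Real.log (n k) / (n k))) =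
      Real.sqrt (δ ^ (d - 2) * ∏ k ∈ S, Real.log (n k) / (n k)) := by
    rw [← Real.sqrt_prod _ fun k _ => mul_nonneg hδ.le (hlog k), Finset.prod_mul_distrib,
      Finset.prod_const, hScard]
  have hevent : roundingEvent m F S
      ((∏ k ∈ S, Real.sqrt (δ * (Real.log (n k) / (n k)))) * sSup R) =
      {K | ∃ x : (k : Fin d) → (Fin (n k) → Fin m),
        (∀ k : Fin d, (k : ℕ) < d - 2 → x k = K k) ∧
        Real.sqrt (δ ^ (d - 2) * ∏ k ∈ S, Real.log (n k) / (n k)) * sSup R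
          ≤ (F (fun k i => omegaRoot m (x k i))).re} := by
    rw [hsqrt]
    ext K
    simp only [roundingEvent, hS, Finset.mem_filter, Finset.mem_univ, true_and]
  rw [hevent, Finset.prod_mul_distrib, Finset.prod_const, hScard, Finset.prod_inv_distrib] at key
  have hmpos : (0 : ℝ) < m := by exact_mod_cast hm0
  rw [le_div_iff₀ (by positivity)]
  refine le_trans ?_ key
  have hfac : (1 : ℝ) ≤ m.minFac := by exact_mod_cast m.minFac_pos
  gcongr
  exact div_le_self hc.le hfac
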